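/- Suppose every user k ≠ 1 reports truthfully (d̂_k^t = d_k^t for all t) and user 1 never over-reports (d̂_1^t ≤ d_1^t for all t), both runs starting from zero cumulative allocations. Then for every horizon T, user 1's cumulative allocation under the deviation is at most 1.5 times its truthful cumulative allocation: R̂_1^T ≤ (3/2)·R_1^T; equivalently, Û_1^T ≤ (3/2)·U_1^T, i.e., user 1 cannot increase its total useful allocation by a factor of more than 1.5 by under-reporting its demand. -/

import Mathlib

open Finset

/-- One step of the Karma algorithm with instantaneous guarantee `α = 0`
(assuming no user runs out of credits): from prior cumulative allocations `R`
and reported demands `d`, each user `k` is allocated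
`r k = min (d k) ((lam - R k)⁺)`, where the water level `lam ≥ 0` is such that
`∑ k, r k = min C (∑ k, d k)`. -/
def KarmaStep (n : ℕ) (C : ℝ) (R d r : Fin n → ℝ) : Prop :=
  ∃ lam : ℝ, 0 ≤ lam ∧ (∀ k, r k = min (d k) (max (lam - R k) 0)) ∧
    (∑ k, r k) = min C (∑ k, d k)

/-- Cumulative allocation of user `k` before quantum `t` (quanta are 0-based):
`cum n r t k = ∑_{τ < t} r τ k`. -/
def cum (n : ℕ) (r : ℕ → Fin n → ℝ) (t : ℕ) (k : Fin n) : ℝ :=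
  ∑ τ ∈ Finset.range t, r τ k

/-- A run of the Karma algorithm over quanta `0, 1, 2, …` with reported
demands `d t` and allocations `r t`, starting from zero cumulative
allocations. -/
def KarmaRun (n : ℕ) (C : ℝ) (d r : ℕ → Fin n → ℝ) : Prop :=
  ∀ t, KarmaStep n C (cum n r t) (d t) (r t)

/-- The allocation `min d (max (lam - R) 0)` strictly exceeding another one that has at least the
same demand bounds the difference of the cumulative allocations by that of the water levels. -/
lemma alloc_diff_le_level_diff {lam lam' R R' d d' : ℝ} (hd : 0 ≤ d) (hdd : d' ≤ d)
    (h : min d (max (lam - R) 0) < min d' (max (lam' - R') 0)) :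
    (R' + min d' (max (lam' - R') 0)) - (R + min d (max (lam - R) 0)) ≤ lam' - lam := by
  grind

lemma cum_succ (n : ℕ) (r : ℕ → Fin n → ℝ) (t : ℕ) (k : Fin n) :
    cum n r (t + 1) k = cum n r t k + r t k :=
  Finset.sum_range_succ _ _

namespace KarmaStep

variable {n : ℕ} {C : ℝ} {R R' d d' r r' : Fin n → ℝ}

lemma nonneg (h : KarmaStep n C R d r) (hd : ∀ k, 0 ≤ d k) (k : Fin n) : 0 ≤ r k := by
  obtain ⟨lam, -, hr, -⟩ := h
  rw [hr]
  exact le_min (hd k) (le_max_right _ _)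

lemma le_demand (h : KarmaStep n C R d r) (k : Fin n) : r k ≤ d k := by
  obtain ⟨lam, -, hr, -⟩ := h
  rw [hr]
  exact min_le_left _ _

lemma sum_le_sum (h : KarmaStep n C R d r) (h' : KarmaStep n C R' d' r')
    (hle : ∀ k, d' k ≤ d k) : ∑ k, r' k ≤ ∑ k, r k := by
  obtain ⟨-, -, -, hs⟩ := h
  obtain ⟨-, -, -, hs'⟩ := h'
  rw [hs, hs']
  exact min_le_min_left _ (Finset.sum_le_sum fun k _ => hle k)

/-- The difference `c` of the water levels separates the users that gain from those that lose:
gaining users end up at most `c` ahead, losing users with unchanged demand at least `c` ahead. -/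
lemma exists_threshold (h : KarmaStep n C R d r) (h' : KarmaStep n C R' d' r')
    (hd : ∀ k, 0 ≤ d k) (hd' : ∀ k, 0 ≤ d' k) (hle : ∀ k, d' k ≤ d k) :
    ∃ c : ℝ, (∀ k, r k < r' k → (R' k + r' k) - (R k + r k) ≤ c) ∧
      ∀ k, d' k = d k → r' k < r k → c ≤ (R' k + r' k) - (R k + r k) := by
  obtain ⟨lam, -, hr, -⟩ := h
  obtain ⟨lam', -, hr', -⟩ := h'
  refine ⟨lam' - lam, fun k hk => ?_, fun k hdk hk => ?_⟩
  · rw [hr, hr'] at hk ⊢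
    exact alloc_diff_le_level_diff (hd k) (hle k) hk
  · rw [hr, hr'] at hk ⊢
    linarith [alloc_diff_le_level_diff (hd' k) hdk.ge hk]

/-- When only `u` lowers its demand, the total lead of the users that are ahead grows by at most
the allocation of `u`. -/
lemma sum_posPart_le (h : KarmaStep n C R d r) (h' : KarmaStep n C R' d' r')
    (hd : ∀ k, 0 ≤ d k) (hd' : ∀ k, 0 ≤ d' k) (hle : ∀ k, d' k ≤ d k) {u : Fin n}
    (hsame : ∀ k, k ≠ u → d' k = d k) :
    ∑ k, max ((R' k + r' k) - (R k + r k)) 0 ≤ ∑ k, max (R' k - R k) 0 + r u := by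
  obtain ⟨c, hgain, hlose⟩ := h.exists_threshold h' hd hd' hle
  have hu := h.nonneg hd u
  have hu' := h'.nonneg hd' u
  rcases le_or_gt 0 c with hc | hc
  · have hstep : ∀ k, max ((R' k + r' k) - (R k + r k)) 0 ≤
        max (R' k - R k) 0 + (r' k - r k) + if k = u then r u else 0 := by
      intro k
      by_cases hk : k = u
      · subst hk
        grind
      · have := hlose k (hsame k hk)
        grind
    calc _ ≤ ∑ k, (max (R' k - R k) 0 + (r' k - r k) + if k = u then r u else 0) :=
          Finset.sum_le_sum fun k _ => hstep k
      _ = ∑ k, max (R' k - R k) 0 + (∑ k, r' k - ∑ k, r k) + r u := by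
          simp [Finset.sum_add_distrib]
      _ ≤ _ := by linarith [h.sum_le_sum h' hle]
  · have hstep : ∀ k, max ((R' k + r' k) - (R k + r k)) 0 ≤ max (R' k - R k) 0 := by
      intro k
      have := hgain k
      grind
    linarith [Finset.sum_le_sum fun k (_ : k ∈ Finset.univ) => hstep k]

/-- If `u` gains by lowering its demand, then some other user ends up at least as far ahead. -/
lemma exists_ge_of_gain (h : KarmaStep n C R d r) (h' : KarmaStep n C R' d' r')
    (hd : ∀ k, 0 ≤ d k) (hd' : ∀ k, 0 ≤ d' k) (hle : ∀ k, d' k ≤ d k) {u : Fin n}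
    (hsame : ∀ k, k ≠ u → d' k = d k) (hu : r u < r' u) :
    ∃ j, j ≠ u ∧ (R' u + r' u) - (R u + r u) ≤ (R' j + r' j) - (R j + r j) := by
  obtain ⟨c, hgain, hlose⟩ := h.exists_threshold h' hd hd' hle
  obtain ⟨j, hj⟩ : ∃ j, r' j < r j := by
    by_contra! hall
    exact (Finset.sum_lt_sum (fun k _ => hall k) ⟨u, Finset.mem_univ u, hu⟩).not_ge
      (h.sum_le_sum h' hle)
  have hne : j ≠ u := by
    rintro rfl
    exact hj.not_gt hu
  exact ⟨j, hne, (hgain u hu).trans (hlose j (hsame j hne) hj)⟩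

end KarmaStep

/-- (Lemma 2, upper bound.) If every user other than `u` reports truthfully
and user `u` never over-reports (`dh t u ≤ d t u` for all `t`), then for every
horizon `T`, user `u`'s cumulative allocation under the deviation is at most
`3/2` times its truthful cumulative allocation, and equivalently its total
useful allocation under the deviation is at most `3/2` times its truthful
total useful allocation. Both runs start from zero cumulative allocations. -/
theorem karma_underreport_at_most_three_halves (n : ℕ) (C : ℝ) (hC : 0 < C)
    (u : Fin n) (d dh r rh : ℕ → Fin n → ℝ)
    (hd : ∀ t k, 0 ≤ d t k) (hdh : ∀ t k, 0 ≤ dh t k)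
    (hsame : ∀ t, ∀ k, k ≠ u → dh t k = d t k)
    (hunder : ∀ t, dh t u ≤ d t u)
    (hrun : KarmaRun n C d r) (hrunh : KarmaRun n C dh rh) (T : ℕ) :
    cum n rh T u ≤ (3 / 2) * cum n r T u ∧
    (∑ t ∈ Finset.range T, min (rh t u) (d t u)) ≤
      (3 / 2) * (∑ t ∈ Finset.range T, min (r t u) (d t u)) := by
  have hle : ∀ t k, dh t k ≤ d t k := by
    intro t k
    by_cases hk : k = u
    · exact hk ▸ hunder t
    · exact (hsame t k hk).le
  have hpos : ∀ t, ∑ k, max (cum n rh t k - cum n r t k) 0 ≤ cum n r t u := by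
    intro t
    induction t with
    | zero => simp [cum]
    | succ t ih =>
      simp only [cum_succ]
      linarith [(hrun t).sum_posPart_le (hrunh t) (hd t) (hdh t) (hle t) (hsame t)]
  have hmain : ∀ t, cum n rh t u ≤ (3 / 2) * cum n r t u := by
    intro t
    induction t with
    | zero => simp [cum]
    | succ t ih =>
      rcases le_or_gt (rh t u) (r t u) with hu | hu
      · rw [cum_succ, cum_succ]
        linarith [(hrun t).nonneg (hd t) u]
      · obtain ⟨j, hj, hlead⟩ :=
          (hrun t).exists_ge_of_gain (hrunh t) (hd t) (hdh t) (hle t) (hsame t) hu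
        simp only [← cum_succ] at hlead
        have hpair := Finset.add_le_sum (s := Finset.univ)
          (f := fun k => max (cum n rh (t + 1) k - cum n r (t + 1) k) 0)
          (fun k _ => le_max_right _ _) (Finset.mem_univ u) (Finset.mem_univ j) hj.symm
        linarith [hpos (t + 1), le_max_left (cum n rh (t + 1) u - cum n r (t + 1) u) 0,
          le_max_left (cum n rh (t + 1) j - cum n r (t + 1) j) 0]
  refine ⟨hmain T, ?_⟩
  have huseful : ∀ t, min (r t u) (d t u) = r t u := fun t =>
    min_eq_left ((hrun t).le_demand u)
  have huseful' : ∀ t, min (rh t u) (d t u) = rh t u := fun t =>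
    min_eq_left (((hrunh t).le_demand u).trans (hunder t))
  simp only [huseful, huseful']
  exact hmain T
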